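/- Let V, E, K be finite index sets and B ∈ ℝ^{V×E}. Fix β > 1 and d_e, b_e > 0 for all e ∈ E. For a capacity vector f̄ ∈ ℝ^E with f̄_e > 0 for all e, define the Wardrop flow cost c_f(F, f̄) = Σ_{e∈E} ( d_e·f_e + (1/β)·b_e·f̄_e·(f_e/f̄_e)^β ), where f_e = Σ_{k∈K} F_{e,k}. Then for every U ∈ ℝ^{V×K}, every capacity vector f̄ with strictly positive entries, and every ω > 0: a nonnegative matrix F ∈ ℝ_+^{E×K} minimizes c_f(·, f̄) over {F' ∈ ℝ_+^{E×K} : B·F' = U} if and only if ω·F minimizes c_f(·, ω·f̄) over {F' ∈ ℝ_+^{E×K} : B·F' = ω·U}. Consequently, if the minimizer is unique for each input, the minimal-cost flow satisfies F*(ω U, ω f̄) = ω·F*(U, f̄). -/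

import Mathlib

/-- `F` minimizes the cost `cf` over the feasible set `Feas`. -/
def IsMinimizer {M : Type*} (cf : M → ℝ) (Feas : Set M) (F : M) : Prop :=
  F ∈ Feas ∧ ∀ F' ∈ Feas, cf F ≤ cf F'

/-- The Wardrop flow cost
`c_f(F, f̄) = Σ_e ( d_e·f_e + (1/β)·b_e·f̄_e·(f_e/f̄_e)^β )`, where
`f_e = Σ_k F_{e,k}` is the total flow on edge `e`. -/
noncomputable def wardropCost {E K : Type*} [Fintype E] [Fintype K]
    (β : ℝ) (d b : E → ℝ) (fbar : E → ℝ) (F : Matrix E K ℝ) : ℝ :=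
  ∑ e, (d e * (∑ k, F e k) + (1/β) * b e * fbar e * ((∑ k, F e k) / fbar e) ^ β)

/-- The Wardrop cost is positively homogeneous of degree one in flow and capacity jointly. -/
theorem wardropCost_smul {E K : Type*} [Fintype E] [Fintype K]
    (β : ℝ) (d b fbar : E → ℝ) {ω : ℝ} (hω : ω ≠ 0) (F : Matrix E K ℝ) :
    wardropCost β d b (ω • fbar) (ω • F) = ω * wardropCost β d b fbar F := by
  simp only [wardropCost, Finset.mul_sum (s := (Finset.univ : Finset E)), Matrix.smul_apply,
    Pi.smul_apply, smul_eq_mul, ← Finset.mul_sum (s := (Finset.univ : Finset K)),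
    mul_div_mul_left _ _ hω]
  exact Finset.sum_congr rfl fun e _ => by ring

theorem IsMinimizer.wardropCost_smul {V E K : Type*} [Fintype E] [Fintype K]
    {B : Matrix V E ℝ} {β : ℝ} {d b fbar : E → ℝ} {U : Matrix V K ℝ} {F : Matrix E K ℝ}
    (h : IsMinimizer (wardropCost β d b fbar) {F' | (∀ e k, 0 ≤ F' e k) ∧ B * F' = U} F)
    {ω : ℝ} (hω : 0 < ω) :
    IsMinimizer (wardropCost β d b (ω • fbar))
      {F' | (∀ e k, 0 ≤ F' e k) ∧ B * F' = ω • U} (ω • F) := by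
  obtain ⟨⟨hF, hU⟩, hmin⟩ := h
  refine ⟨⟨fun e k => mul_nonneg hω.le (hF e k), by rw [Matrix.mul_smul, hU]⟩, ?_⟩
  rintro G ⟨hG, hGU⟩
  have hle := hmin (ω⁻¹ • G) ⟨fun e k => mul_nonneg (inv_nonneg.2 hω.le) (hG e k), by
    rw [Matrix.mul_smul, hGU, inv_smul_smul₀ hω.ne']⟩
  have hcost := _root_.wardropCost_smul β d b fbar hω.ne' (ω⁻¹ • G)
  rw [smul_inv_smul₀ hω.ne'] at hcost
  rw [_root_.wardropCost_smul β d b fbar hω.ne', hcost]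
  exact mul_le_mul_of_nonneg_left hle hω.le

/-- For the Wardrop cost with `β > 1` and `d_e, b_e > 0`, a
nonnegative flow `F` minimizes `c_f(·, f̄)` over `{F' ≥ 0 : B·F' = U}` iff `ω·F`
minimizes `c_f(·, ω·f̄)` over `{F' ≥ 0 : B·F' = ω·U}`; consequently a unique
minimal-cost flow satisfies `F*(ωU, ωf̄) = ω·F*(U, f̄)`. -/
theorem stmt5
    {V E K : Type*} [Fintype V] [Fintype E] [Fintype K]
    (B : Matrix V E ℝ)
    (β : ℝ) (hβ : 1 < β)
    (d b : E → ℝ) (hd : ∀ e, 0 < d e) (hb : ∀ e, 0 < b e) :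
    (∀ (U : Matrix V K ℝ) (fbar : E → ℝ), (∀ e, 0 < fbar e) → ∀ (ω : ℝ), 0 < ω →
      ∀ F : Matrix E K ℝ,
        (IsMinimizer (wardropCost β d b fbar)
            {F' | (∀ e k, 0 ≤ F' e k) ∧ B * F' = U} F ↔
          IsMinimizer (wardropCost β d b (ω • fbar))
            {F' | (∀ e k, 0 ≤ F' e k) ∧ B * F' = ω • U} (ω • F)))
    ∧ ∀ Fstar : Matrix V K ℝ → (E → ℝ) → Matrix E K ℝ,
        (∀ (U : Matrix V K ℝ) (fbar : E → ℝ), (∀ e, 0 < fbar e) →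
          IsMinimizer (wardropCost β d b fbar)
            {F' | (∀ e k, 0 ≤ F' e k) ∧ B * F' = U} (Fstar U fbar) ∧
          ∀ G : Matrix E K ℝ,
            IsMinimizer (wardropCost β d b fbar)
              {F' | (∀ e k, 0 ≤ F' e k) ∧ B * F' = U} G → G = Fstar U fbar) →
        ∀ (U : Matrix V K ℝ) (fbar : E → ℝ), (∀ e, 0 < fbar e) → ∀ (ω : ℝ), 0 < ω →
          Fstar (ω • U) (ω • fbar) = ω • Fstar U fbar := by
  refine ⟨fun U fbar _ ω hω F => ⟨fun h => h.wardropCost_smul hω, fun h => ?_⟩,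
    fun Fstar h U fbar hfbar ω hω => ?_⟩
  · simpa only [inv_smul_smul₀ hω.ne'] using h.wardropCost_smul (inv_pos.2 hω)
  · exact ((h (ω • U) (ω • fbar) fun e => mul_pos hω (hfbar e)).2 _
      ((h U fbar hfbar).1.wardropCost_smul hω)).symm
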